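/- Gadget locality bound: suppose the q-th order term V^{(q)} in the local Schrieffer-Wolff expansion satisfies the inductive recursion in which V^{(1)} = H^{(1)} and for q ≥ 2, V^{(q)} is a sum of nested commutators [T^{(q_1)},[…,[T^{(q_r)}, H^{(α)}]…]] with q_1+…+q_r = q−α, where each T^{(q')} has the same locality as V^{(q')}, H^{(0)} is 1-local, and H^{(α)} is k'-local for α ≥ 1. Then V^{(q)} is (q(k'−1)+1)-local for every q ≥ 1. Consequently, if a degree-d gadget H'(x) built from k'-local terms simulates a k-local Hamiltonian, then d ≥ (k−1)/(k'−1). -/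

import Mathlib

/-- Operators on a system of qubits indexed by the finite site set `Γ`. -/
abbrev SpinOp (Γ : Type*) [Fintype Γ] [DecidableEq Γ] :=
  Matrix (Γ → Fin 2) (Γ → Fin 2) ℂ

/-- `M` is supported on the set of sites `A`: it acts as the identity outside `A`,
i.e. its matrix elements vanish between configurations differing outside `A` and
depend only on the restriction of the configurations to `A`. -/
def SupportedOn {Γ : Type*} [Fintype Γ] [DecidableEq Γ]
    (A : Finset Γ) (M : SpinOp Γ) : Prop :=
  (∀ s t : Γ → Fin 2, (∃ i ∉ A, s i ≠ t i) → M s t = 0) ∧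
  (∀ s t s' t' : Γ → Fin 2, (∀ i ∈ A, s i = s' i) → (∀ i ∈ A, t i = t' i) →
    (∀ i ∉ A, s i = t i) → (∀ i ∉ A, s' i = t' i) → M s t = M s' t')

/-- `M` is `k`-local: it is a sum of terms each supported on at most `k` sites. -/
def IsKLocal {Γ : Type*} [Fintype Γ] [DecidableEq Γ] (k : ℕ) (M : SpinOp Γ) : Prop :=
  ∃ X : Finset Γ → SpinOp Γ, M = ∑ A : Finset Γ, X A ∧
    (∀ A, SupportedOn A (X A)) ∧ ∀ A : Finset Γ, X A ≠ 0 → A.card ≤ k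

/-- The nested commutator `[L₁, [L₂, …, [L_r, Z]⋯]]`. -/
noncomputable def nestedComm {Γ : Type*} [Fintype Γ] [DecidableEq Γ]
    (L : List (SpinOp Γ)) (Z : SpinOp Γ) : SpinOp Γ :=
  L.foldr (fun A B => A * B - B * A) Z

section Locality

variable {Γ : Type*} [Fintype Γ] [DecidableEq Γ]

namespace SupportedOn

variable {A B : Finset Γ} {M N : SpinOp Γ}

theorem zero (A : Finset Γ) : SupportedOn A (0 : SpinOp Γ) :=
  ⟨fun _ _ _ => rfl, fun _ _ _ _ _ _ _ _ => rfl⟩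

theorem add (hM : SupportedOn A M) (hN : SupportedOn A N) : SupportedOn A (M + N) := by
  refine ⟨fun s t h => ?_, fun s t s' t' h₁ h₂ h₃ h₄ => ?_⟩
  · rw [Matrix.add_apply, hM.1 s t h, hN.1 s t h, add_zero]
  · rw [Matrix.add_apply, Matrix.add_apply, hM.2 s t s' t' h₁ h₂ h₃ h₄,
      hN.2 s t s' t' h₁ h₂ h₃ h₄]

theorem smul (c : ℂ) (hM : SupportedOn A M) : SupportedOn A (c • M) := by
  refine ⟨fun s t h => ?_, fun s t s' t' h₁ h₂ h₃ h₄ => ?_⟩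
  · rw [Matrix.smul_apply, hM.1 s t h, smul_zero]
  · rw [Matrix.smul_apply, Matrix.smul_apply, hM.2 s t s' t' h₁ h₂ h₃ h₄]

theorem sub (hM : SupportedOn A M) (hN : SupportedOn A N) : SupportedOn A (M - N) := by
  have h := hM.add (hN.smul (-1))
  rwa [neg_one_smul, ← sub_eq_add_neg] at h

theorem mono (hAB : A ⊆ B) (hM : SupportedOn A M) : SupportedOn B M := by
  refine ⟨fun s t ⟨i, hi, hst⟩ => hM.1 s t ⟨i, fun h => hi (hAB h), hst⟩,
    fun s t s' t' h₁ h₂ h₃ h₄ => ?_⟩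
  by_cases h : ∃ i ∉ A, s i ≠ t i
  · obtain ⟨i, hiA, hi⟩ := h
    have hiB : i ∈ B := by
      by_contra hiB
      exact hi (h₃ i hiB)
    rw [hM.1 s t ⟨i, hiA, hi⟩, hM.1 s' t' ⟨i, hiA, by rwa [← h₁ i hiB, ← h₂ i hiB]⟩]
  · push Not at h
    refine hM.2 s t s' t' (fun i hi => h₁ i (hAB hi)) (fun i hi => h₂ i (hAB hi)) h
      fun i hi => ?_
    by_cases hiB : i ∈ B
    · rw [← h₁ i hiB, ← h₂ i hiB, h i hi]
    · exact h₄ i hiB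

/-- Matrix elements of `M` are invariant under relabelling the states of sites outside the
support of `M`. -/
theorem apply_piCongrRight (hM : SupportedOn A M) (σ : Γ → Equiv.Perm (Fin 2))
    (hσ : ∀ i ∈ A, σ i = 1) (s t : Γ → Fin 2) :
    M (Equiv.piCongrRight σ s) (Equiv.piCongrRight σ t) = M s t := by
  by_cases h : ∃ i ∉ A, s i ≠ t i
  · obtain ⟨i, hiA, hi⟩ := h
    rw [hM.1 s t ⟨i, hiA, hi⟩, hM.1 _ _ ⟨i, hiA, (σ i).injective.ne hi⟩]
  · push Not at h
    refine hM.2 _ _ _ _ (fun i hi => ?_) (fun i hi => ?_) (fun i hi => ?_) h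
    · simp [hσ i hi]
    · simp [hσ i hi]
    · simp [h i hi]

theorem mul (hM : SupportedOn A M) (hN : SupportedOn A N) : SupportedOn A (M * N) := by
  refine ⟨fun s t ⟨i, hiA, hi⟩ => ?_, fun s t s' t' h₁ h₂ h₃ h₄ => ?_⟩
  · rw [Matrix.mul_apply]
    refine Finset.sum_eq_zero fun u _ => ?_
    by_cases hu : s i = u i
    · rw [hN.1 u t ⟨i, hiA, hu ▸ hi⟩, mul_zero]
    · rw [hM.1 s u ⟨i, hiA, hu⟩, zero_mul]
  · let σ : Γ → Equiv.Perm (Fin 2) := fun i => Equiv.swap (s i) (s' i)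
    have hσ : ∀ i ∈ A, σ i = 1 := fun i hi => by
      simp only [σ, h₁ i hi, Equiv.swap_self]
      rfl
    have hs : Equiv.piCongrRight σ s = s' := by
      funext i
      simp [σ]
    have ht : Equiv.piCongrRight σ t = t' := by
      funext i
      by_cases hi : i ∈ A
      · simp [hσ i hi, h₂ i hi]
      · simp [σ, ← h₃ i hi, ← h₄ i hi]
    rw [Matrix.mul_apply, Matrix.mul_apply, eq_comm, ← Equiv.sum_comp (Equiv.piCongrRight σ)]
    refine Finset.sum_congr rfl fun u _ => ?_
    rw [← hs, ← ht, hM.apply_piCongrRight σ hσ, hN.apply_piCongrRight σ hσ]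

theorem mul_union (hM : SupportedOn A M) (hN : SupportedOn B N) :
    SupportedOn (A ∪ B) (M * N) :=
  (hM.mono Finset.subset_union_left).mul (hN.mono Finset.subset_union_right)

theorem commutator (hM : SupportedOn A M) (hN : SupportedOn B N) :
    SupportedOn (A ∪ B) (M * N - N * M) :=
  (hM.mul_union hN).sub (Finset.union_comm B A ▸ hN.mul_union hM)

/-- If `s` and `t` agree off `A ∪ B`, only one intermediate configuration contributes to a
matrix element of a product of operators with disjoint supports. -/
theorem mul_apply_of_disjoint (hAB : Disjoint A B) (hM : SupportedOn A M)
    (hN : SupportedOn B N) (s t : Γ → Fin 2) :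
    (M * N) s t = M s (A.piecewise t s) * N (A.piecewise t s) t := by
  rw [Matrix.mul_apply]
  refine Finset.sum_eq_single _ (fun u _ hu => ?_) (fun h => absurd (Finset.mem_univ _) h)
  obtain ⟨i, hi⟩ := Function.ne_iff.mp hu
  by_cases hiA : i ∈ A
  · rw [Finset.piecewise_eq_of_mem _ _ _ hiA] at hi
    rw [hN.1 u t ⟨i, Finset.disjoint_left.mp hAB hiA, hi⟩, mul_zero]
  · rw [Finset.piecewise_eq_of_notMem _ _ _ hiA] at hi
    rw [hM.1 s u ⟨i, hiA, hi.symm⟩, zero_mul]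

theorem commute_of_disjoint (hAB : Disjoint A B) (hM : SupportedOn A M)
    (hN : SupportedOn B N) : M * N = N * M := by
  ext s t
  by_cases h : ∃ i ∉ A ∪ B, s i ≠ t i
  · rw [(hM.mul_union hN).1 s t h, (hN.mul_union hM).1 s t (Finset.union_comm A B ▸ h)]
  · push Not at h
    have hdisj : ∀ i ∈ B, i ∉ A := fun i hB hA => Finset.disjoint_left.mp hAB hA hB
    have hoff : ∀ i, i ∉ A → i ∉ B → s i = t i := fun i hA hB => h i (by simp [hA, hB])
    rw [hM.mul_apply_of_disjoint hAB hN, hN.mul_apply_of_disjoint hAB.symm hM, mul_comm]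
    congr 1
    · apply hN.2 <;> intro i hi <;> by_cases hA : i ∈ A <;> by_cases hB : i ∈ B <;>
        simp_all [Finset.piecewise]
    · apply hM.2 <;> intro i hi <;> by_cases hA : i ∈ A <;> by_cases hB : i ∈ B <;>
        simp_all [Finset.piecewise]

end SupportedOn

namespace IsKLocal

variable {k l : ℕ} {M N : SpinOp Γ}

theorem mono (hkl : k ≤ l) (hM : IsKLocal k M) : IsKLocal l M := by
  obtain ⟨X, hX, hsupp, hcard⟩ := hM
  exact ⟨X, hX, hsupp, fun A hA => (hcard A hA).trans hkl⟩

theorem of_supportedOn {A : Finset Γ} (hM : SupportedOn A M) (hA : A.card ≤ k) :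
    IsKLocal k M := by
  refine ⟨Pi.single A M, by simp, fun B => ?_, fun B hB => ?_⟩
  · by_cases h : B = A
    · subst h
      simpa using hM
    · simpa [h] using SupportedOn.zero B
  · by_cases h : B = A
    · exact h ▸ hA
    · simp [h] at hB

theorem zero (k : ℕ) : IsKLocal k (0 : SpinOp Γ) :=
  of_supportedOn (SupportedOn.zero ∅) (by simp)

theorem add (hM : IsKLocal k M) (hN : IsKLocal k N) : IsKLocal k (M + N) := by
  obtain ⟨X, rfl, hX, hX'⟩ := hM
  obtain ⟨Y, rfl, hY, hY'⟩ := hN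
  refine ⟨fun A => X A + Y A, Finset.sum_add_distrib.symm, fun A => (hX A).add (hY A),
    fun A hA => ?_⟩
  by_cases h : X A = 0
  · exact hY' A fun h' => hA (by simp only [h, h', add_zero])
  · exact hX' A h

theorem smul (c : ℂ) (hM : IsKLocal k M) : IsKLocal k (c • M) := by
  obtain ⟨X, rfl, hX, hX'⟩ := hM
  exact ⟨fun A => c • X A, Finset.smul_sum, fun A => (hX A).smul c,
    fun A hA => hX' A fun h => hA (by simp only [h, smul_zero])⟩

theorem sum {ι : Type*} (s : Finset ι) (f : ι → SpinOp Γ) (hf : ∀ i ∈ s, IsKLocal k (f i)) :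
    IsKLocal k (∑ i ∈ s, f i) :=
  Finset.sum_induction f (IsKLocal k) (fun _ _ => add) (zero k) hf

theorem commutator (hM : IsKLocal (k + 1) M) (hN : IsKLocal (l + 1) N) :
    IsKLocal (k + l + 1) (M * N - N * M) := by
  obtain ⟨X, rfl, hX, hX'⟩ := hM
  obtain ⟨Y, rfl, hY, hY'⟩ := hN
  have hexp : (∑ A, X A) * (∑ B, Y B) - (∑ B, Y B) * (∑ A, X A)
      = ∑ A, ∑ B, (X A * Y B - Y B * X A) := by
    simp only [Finset.sum_sub_distrib]
    rw [Finset.sum_mul_sum, Finset.sum_mul_sum, Finset.sum_comm (γ := Finset Γ)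
      (f := fun B A => Y B * X A)]
  rw [hexp]
  refine sum _ _ fun A _ => sum _ _ fun B _ => ?_
  by_cases hA : X A = 0
  · simpa [hA] using zero _
  by_cases hB : Y B = 0
  · simpa [hB] using zero _
  by_cases hAB : Disjoint A B
  · rw [(hX A).commute_of_disjoint hAB (hY B), sub_self]
    exact zero _
  · refine of_supportedOn ((hX A).commutator (hY B)) ?_
    have hinter : 0 < (A ∩ B).card :=
      Finset.card_pos.mpr (Finset.not_disjoint_iff_nonempty_inter.mp hAB)
    have hunion := Finset.card_union_add_card_inter A B
    have hcardA := hX' A hA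
    have hcardB := hY' B hB
    omega

theorem nestedComm_map {m a : ℕ} {T : ℕ → SpinOp Γ} {Z : SpinOp Γ}
    (hZ : IsKLocal (a * m + 1) Z) (L : List ℕ)
    (hT : ∀ q ∈ L, IsKLocal (q * m + 1) (T q)) :
    IsKLocal ((L.sum + a) * m + 1) (nestedComm (L.map T) Z) := by
  induction L with
  | nil => simpa [nestedComm] using hZ
  | cons q L ih =>
    have h := (hT q List.mem_cons_self).commutator
      (ih fun q' hq' => hT q' (List.mem_cons_of_mem _ hq'))
    rwa [← add_mul, ← add_assoc, ← List.sum_cons] at h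

end IsKLocal

end Locality

/-- Gadget locality bound. Suppose the Schrieffer-Wolff series `V^{(q)}` satisfies
`V^{(1)} = H^{(1)}` and, for `q ≥ 2`, `V^{(q)}` is a linear combination of nested
commutators `[T^{(q₁)},[…,[T^{(q_r)}, H^{(α)}]⋯]]` with `q₁+…+q_r + α = q` and each
`q_i ∈ [1, q)`, where each `T^{(q')}` has the same locality as `V^{(q')}`, `H^{(0)}` is
`1`-local and `H^{(α)}` is `k'`-local for `α ≥ 1`. Then `V^{(q)}` is `(q(k'−1)+1)`-local
for every `q ≥ 1`; consequently, if the degree-`d` effective term `V^{(d)}` is genuinely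
`k`-local (i.e. not `(k−1)`-local), then `k − 1 ≤ d(k'−1)`, i.e. `d ≥ (k−1)/(k'−1)`. -/
theorem schriefferWolff_locality {Γ : Type*} [Fintype Γ] [DecidableEq Γ]
    (k' d k : ℕ) (hk' : 2 ≤ k')
    (H T V : ℕ → SpinOp Γ)
    (hH0 : IsKLocal 1 (H 0)) (hHα : ∀ α, 1 ≤ α → IsKLocal k' (H α))
    (hV1 : V 1 = H 1)
    (hT : ∀ q k₀, IsKLocal k₀ (V q) → IsKLocal k₀ (T q))
    (hrec : ∀ q, 2 ≤ q → ∃ (ι : Type) (s : Finset ι) (c : ι → ℂ)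
      (qs : ι → List ℕ) (α : ι → ℕ),
        V q = ∑ i ∈ s, c i • nestedComm ((qs i).map T) (H (α i)) ∧
        (∀ i ∈ s, (qs i).sum + α i = q) ∧
        (∀ i ∈ s, ∀ q' ∈ qs i, 1 ≤ q' ∧ q' < q)) :
    (∀ q, 1 ≤ q → IsKLocal (q * (k' - 1) + 1) (V q)) ∧
      (1 ≤ d → ¬ IsKLocal (k - 1) (V d) → k - 1 ≤ d * (k' - 1)) := by
  have hH : ∀ α, IsKLocal (α * (k' - 1) + 1) (H α) := by
    intro α
    rcases Nat.eq_zero_or_pos α with rfl | hα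
    · simpa using hH0
    · refine (hHα α hα).mono ?_
      have := Nat.le_mul_of_pos_left (k' - 1) hα
      omega
  have hV : ∀ q, 1 ≤ q → IsKLocal (q * (k' - 1) + 1) (V q) := by
    intro q
    induction q using Nat.strong_induction_on with
    | _ q ih =>
      intro hq
      rcases hq.eq_or_lt with rfl | hq
      · exact hV1 ▸ hH 1
      · obtain ⟨ι, s, c, qs, α, hVq, hsum, hlt⟩ := hrec q hq
        rw [hVq]
        refine IsKLocal.sum _ _ fun i hi => IsKLocal.smul _ ?_
        rw [← hsum i hi]
        exact (hH (α i)).nestedComm_map _ fun q' hq' =>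
          hT _ _ (ih q' (hlt i hi q' hq').2 (hlt i hi q' hq').1)
  refine ⟨hV, fun hd hk => ?_⟩
  by_contra! hlt
  exact hk ((hV d hd).mono hlt)
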